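/- For l < 0, a > 0, define G(k) = (−2/(a²l)) · 2/(1 + √(1+8k)) for k = r/(al)², r > 0. Then G(r/(al)²) = ∫_0^∞ e^{−rτ} Θ(τ) dτ, where Θ(τ) = √(2/π) e^{−(l/2)² a² τ/2} / √(a²τ) + l·N((l/2)√(a²τ)) and N is the standard normal CDF. -/

import Mathlib

open Set Real MeasureTheory

/-- The standard normal cumulative distribution function. -/
noncomputable def stdNormalCDF (z : ℝ) : ℝ :=
  (∫ t in Iic z, Real.exp (-(t^2) / 2)) / Real.sqrt (2 * Real.pi)

open Filter Topology

lemma integrable_exp_neg_sq_div_two : Integrable fun t : ℝ => Real.exp (-(t ^ 2) / 2) := by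
  refine (integrable_exp_neg_mul_sq (b := 1 / 2) (by norm_num)).congr (ae_of_all _ fun t => ?_)
  ring_nf

lemma stdNormalCDF_zero : stdNormalCDF 0 = 1 / 2 := by
  have h := integral_gaussian_Ioi (1 / 2)
  have h2 := integral_comp_neg_Iic (0 : ℝ) fun t : ℝ => Real.exp (-(1 / 2) * t ^ 2)
  rw [neg_zero, h] at h2
  have h3 : (∫ t in Iic (0 : ℝ), Real.exp (-(t ^ 2) / 2)) = √(π / (1 / 2)) / 2 := by
    rw [← h2]
    congr 1
    ext t
    ring_nf
  rw [stdNormalCDF, h3, show π / (1 / 2) = 2 * π by ring]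
  have : √(2 * π) ≠ 0 := by positivity
  field_simp

lemma stdNormalCDF_nonneg (z : ℝ) : 0 ≤ stdNormalCDF z :=
  div_nonneg (integral_nonneg fun _ => (Real.exp_pos _).le) (Real.sqrt_nonneg _)

lemma stdNormalCDF_mono : Monotone stdNormalCDF := fun x y hxy => by
  refine div_le_div_of_nonneg_right ?_ (Real.sqrt_nonneg _)
  exact setIntegral_mono_set integrable_exp_neg_sq_div_two.integrableOn
    (ae_of_all _ fun _ => (Real.exp_pos _).le) (Iic_subset_Iic.2 hxy).eventuallyLE

lemma hasDerivAt_stdNormalCDF (z : ℝ) :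
    HasDerivAt stdNormalCDF (Real.exp (-(z ^ 2) / 2) / √(2 * π)) z := by
  have hc : Continuous fun t : ℝ => Real.exp (-(t ^ 2) / 2) := by fun_prop
  have h : stdNormalCDF = fun x => ((∫ t in (0 : ℝ)..x, Real.exp (-(t ^ 2) / 2))
      + ∫ t in Iic (0 : ℝ), Real.exp (-(t ^ 2) / 2)) / √(2 * π) := by
    ext x
    rw [← intervalIntegral.integral_Iic_sub_Iic integrable_exp_neg_sq_div_two.integrableOn
      integrable_exp_neg_sq_div_two.integrableOn, sub_add_cancel, stdNormalCDF]
  rw [h]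
  exact ((intervalIntegral.integral_hasDerivAt_right (hc.intervalIntegrable _ _)
    hc.stronglyMeasurable.stronglyMeasurableAtFilter hc.continuousAt).add_const _).div_const _

lemma integral_exp_neg_mul_div_sqrt {c : ℝ} (hc : 0 < c) :
    ∫ τ in Ioi (0 : ℝ), Real.exp (-(c * τ)) / √τ = √π / √c := by
  have h := Real.integral_rpow_mul_exp_neg_mul_Ioi (a := 1 / 2) (r := c) (by norm_num) hc
  rw [Real.Gamma_one_half_eq, ← Real.sqrt_eq_rpow, Real.sqrt_div zero_le_one, Real.sqrt_one] at h
  rw [show √π / √c = 1 / √c * √π by ring, ← h]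
  refine setIntegral_congr_fun measurableSet_Ioi fun τ hτ => ?_
  have hτ' : (0 : ℝ) < τ := hτ
  rw [show (1 / 2 - 1 : ℝ) = -(1 / 2) by norm_num, Real.rpow_neg hτ'.le, ← Real.sqrt_eq_rpow]
  ring

lemma integrableOn_exp_neg_mul_div_sqrt {c : ℝ} (hc : 0 < c) :
    IntegrableOn (fun τ : ℝ => Real.exp (-(c * τ)) / √τ) (Ioi 0) := by
  by_contra h
  have h1 := integral_exp_neg_mul_div_sqrt hc
  rw [integral_undef h] at h1
  have : 0 < √π / √c := by positivity
  exact this.ne h1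

lemma integral_exp_neg_mul_stdNormalCDF {r b : ℝ} (hr : 0 < r) (hb : 0 < b) :
    IntegrableOn (fun τ => Real.exp (-r * τ) * stdNormalCDF (-b * √τ)) (Ioi 0) ∧
    ∫ τ in Ioi (0 : ℝ), Real.exp (-r * τ) * stdNormalCDF (-b * √τ)
      = 1 / (2 * r) * (1 - b / √(2 * r + b ^ 2)) := by
  set c := r + b ^ 2 / 2 with hc
  have hc0 : 0 < c := by positivity
  set K := b / (2 * r * √(2 * π)) with hK
  have hK0 : 0 < K := by positivity
  let G : ℝ → ℝ := fun τ => -(Real.exp (-r * τ) * stdNormalCDF (-b * √τ)) / r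
  let g : ℝ → ℝ := fun τ =>
    Real.exp (-r * τ) * stdNormalCDF (-b * √τ) + K * (Real.exp (-(c * τ)) / √τ)
  have hcdf : Continuous stdNormalCDF :=
    continuous_iff_continuousAt.2 fun z => (hasDerivAt_stdNormalCDF z).continuousAt
  have hG : ContinuousWithinAt G (Ici 0) 0 := by
    have : Continuous G := by fun_prop
    exact this.continuousWithinAt
  have hd : ∀ τ ∈ Ioi (0 : ℝ), HasDerivAt G (g τ) τ := by
    intro τ hτ
    have hτ' : (0 : ℝ) < τ := hτ
    have h1 : HasDerivAt (fun τ : ℝ => Real.exp (-r * τ)) (Real.exp (-r * τ) * (-r * 1)) τ :=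
      ((hasDerivAt_id τ).const_mul (-r)).exp
    have h2 := (hasDerivAt_stdNormalCDF (-b * √τ)).comp τ
      ((Real.hasDerivAt_sqrt hτ'.ne').const_mul (-b))
    have h3 := ((h1.mul h2).neg).div_const r
    refine h3.congr_deriv ?_
    have hs : √τ ≠ 0 := by positivity
    have he : Real.exp (-(c * τ)) = Real.exp (-r * τ) * Real.exp (-((-b * √τ) ^ 2) / 2) := by
      rw [← Real.exp_add, mul_pow, Real.sq_sqrt hτ'.le, hc]
      ring_nf
    have hp : √(2 * π) ≠ 0 := by positivity
    simp only [g, he, hK, Function.comp]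
    field_simp
    ring
  have hg : ∀ τ ∈ Ioi (0 : ℝ), 0 ≤ g τ := fun τ _ => by
    have := stdNormalCDF_nonneg (-b * √τ)
    positivity
  have hlim : Tendsto G atTop (𝓝 0) := by
    have he : Tendsto (fun τ : ℝ => Real.exp (-r * τ)) atTop (𝓝 0) :=
      Real.tendsto_exp_atBot.comp (tendsto_id.const_mul_atTop_of_neg (neg_neg_of_pos hr))
    have hN : Tendsto (fun τ : ℝ => Real.exp (-r * τ) * stdNormalCDF (-b * √τ)) atTop (𝓝 0) := by
      refine squeeze_zero (fun τ => mul_nonneg (Real.exp_pos _).le (stdNormalCDF_nonneg _))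
        (fun τ => ?_) he
      refine mul_le_of_le_one_right (Real.exp_pos _).le ?_
      have hz : -b * √τ ≤ 0 := by nlinarith [Real.sqrt_nonneg τ]
      have := stdNormalCDF_mono hz
      rw [stdNormalCDF_zero] at this
      linarith
    simpa [G] using hN.neg.div_const r
  have hgi := integrableOn_Ioi_deriv_of_nonneg hG hd hg hlim
  have hgv := integral_Ioi_of_hasDerivAt_of_nonneg hG hd hg hlim
  have hki := (integrableOn_exp_neg_mul_div_sqrt hc0).const_mul K
  have heq : (fun τ => Real.exp (-r * τ) * stdNormalCDF (-b * √τ))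
      = fun τ => g τ - K * (Real.exp (-(c * τ)) / √τ) := by
    ext τ
    simp only [g]
    ring
  rw [heq]
  refine ⟨hgi.sub hki, ?_⟩
  rw [integral_sub hgi hki, hgv, integral_const_mul, integral_exp_neg_mul_div_sqrt hc0,
    show 2 * r + b ^ 2 = 2 * c by rw [hc]; ring, Real.sqrt_mul zero_le_two, hK,
    Real.sqrt_mul zero_le_two]
  simp only [G, Real.sqrt_zero, mul_zero, Real.exp_zero, stdNormalCDF_zero]
  have h1 : √c ≠ 0 := by positivity
  have h2 : √π ≠ 0 := by positivity
  have h3 : √(2 : ℝ) ≠ 0 := by positivity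
  have h4 : √(2 : ℝ) ^ 2 = 2 := Real.sq_sqrt zero_le_two
  field_simp
  ring_nf

/-- Quadratic normal volatility model: the Laplace transform of
`Θ(τ) = √(2/π) e^(-(l/2)² a² τ/2)/√(a²τ) + l N((l/2)√(a²τ))` is
`(-2/(a²l)) · 2/(1 + √(1+8k))` with `k = r/(al)²`, for `l < 0`, `a > 0`, `r > 0`. -/
theorem qnv_laplace_transform
    (l a r : ℝ) (hl : l < 0) (ha : 0 < a) (hr : 0 < r) :
    (-2 / (a^2 * l)) * (2 / (1 + Real.sqrt (1 + 8 * (r / (a*l)^2))))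
      = ∫ τ in Ioi (0:ℝ), Real.exp (-r * τ) *
          (Real.sqrt (2/Real.pi) * Real.exp (-(l/2)^2 * a^2 * τ / 2) / Real.sqrt (a^2*τ)
            + l * stdNormalCDF ((l/2) * Real.sqrt (a^2*τ))) := by
  obtain ⟨b, hb⟩ : ∃ b, b = -(l * a) / 2 := ⟨_, rfl⟩
  have hb0 : 0 < b := by rw [hb]; nlinarith
  have hl' : l = -(2 * b) / a := by rw [hb]; field_simp
  have hc0 : 0 < r + b ^ 2 / 2 := by positivity
  obtain ⟨hi, hv⟩ := integral_exp_neg_mul_stdNormalCDF hr hb0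
  have hi2 := (integrableOn_exp_neg_mul_div_sqrt hc0).const_mul (√(2 / π) / a)
  have heq : ∀ τ ∈ Ioi (0 : ℝ), Real.exp (-r * τ) *
      (Real.sqrt (2/Real.pi) * Real.exp (-(l/2)^2 * a^2 * τ / 2) / Real.sqrt (a^2*τ)
        + l * stdNormalCDF ((l/2) * Real.sqrt (a^2*τ)))
      = √(2 / π) / a * (Real.exp (-((r + b ^ 2 / 2) * τ)) / √τ)
        + l * (Real.exp (-r * τ) * stdNormalCDF (-b * √τ)) := by
    intro τ _
    rw [Real.sqrt_mul (sq_nonneg a), Real.sqrt_sq ha.le,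
      show l / 2 * (a * √τ) = -b * √τ by rw [hb]; ring,
      show -((r + b ^ 2 / 2) * τ) = -r * τ + -(l/2)^2 * a^2 * τ / 2 by rw [hb]; ring,
      Real.exp_add]
    field_simp
  rw [setIntegral_congr_fun measurableSet_Ioi heq, integral_add hi2 (hi.const_mul l),
    integral_const_mul, integral_const_mul, hv, integral_exp_neg_mul_div_sqrt hc0]
  obtain ⟨s, hs⟩ : ∃ s, s = √(2 * r + b ^ 2) := ⟨_, rfl⟩
  have hs0 : 0 < s := by rw [hs]; positivity
  have hs2 : s ^ 2 = 2 * r + b ^ 2 := by rw [hs, Real.sq_sqrt (by positivity)]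
  have hL : √(1 + 8 * (r / (a * l) ^ 2)) = s / b := by
    rw [show 1 + 8 * (r / (a * l) ^ 2) = (s / b) ^ 2 by
      rw [div_pow, hs2, hl']; field_simp; ring]
    exact Real.sqrt_sq (by positivity)
  have hR : √(2 / π) / a * (√π / √(r + b ^ 2 / 2)) = 2 / (a * s) := by
    rw [show r + b ^ 2 / 2 = s ^ 2 / 2 by rw [hs2]; ring, Real.sqrt_div zero_le_two,
      Real.sqrt_div (sq_nonneg s), Real.sqrt_sq hs0.le]
    have h4 : √(2 : ℝ) ^ 2 = 2 := Real.sq_sqrt zero_le_two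
    have h2 : √π ≠ 0 := by positivity
    field_simp
    linarith
  have hr2 : r = (s - b) * (s + b) / 2 := by linarith [hs2]
  have hsb : s - b ≠ 0 := fun h => by simp [h] at hr2; exact hr.ne' hr2
  have hsb2 : s + b ≠ 0 := by positivity
  rw [hL, hR, ← hs, hr2, hl']
  field_simp
  ring
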